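/- arXiv:2208.08828 — 15 statements merged into one kernel-verified Lean document; each statement's English description precedes it below -/
import Mathlib

section
/- Let (R_i)_{i∈S} be a family of nonzero commutative rings and R = ∏_{i∈S} R_i their direct product. Then the set of tame primes of R equals the union over k ∈ S of the basic open sets D(e_k) = {P ∈ Spec(R) : e_k ∉ P}; in particular, the set of tame primes is an open subset of Spec(R) with the Zariski topology. -/
/-- A prime ideal of a direct product ring `Π i, R i` is *tame* if it is the preimage of a
prime ideal of one of the factors under the projection map. -/
def IsTamePrime {S : Type*} (R : S → Type*) [∀ i, CommRing (R i)]
    (P : Ideal (Π i, R i)) : Prop :=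
  ∃ (k : S) (p : Ideal (R k)), p.IsPrime ∧ P = p.comap (Pi.evalRingHom R k)

/-- If a prime ideal of a product ring avoids the idempotent of the `k`-th factor, it contains the
kernel of the projection to that factor. -/
theorem ker_evalRingHom_le_of_single_one_notMem {S : Type*} [DecidableEq S] {R : S → Type*}
    [∀ i, CommRing (R i)] {P : Ideal (Π i, R i)} (hP : P.IsPrime) {k : S}
    (hk : (Pi.single k 1 : Π i, R i) ∉ P) : RingHom.ker (Pi.evalRingHom R k) ≤ P := by
  intro x hx
  have hxk : x k = 0 := hx
  refine (hP.mem_or_mem (x := x) (y := Pi.single k 1) ?_).resolve_right hk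
  have h : x * Pi.single k 1 = 0 := by
    ext i
    by_cases hi : i = k
    · subst hi
      simp [hxk]
    · simp [hi]
  rw [h]
  exact P.zero_mem

/-- A prime ideal of a product ring is tame iff it avoids the idempotent of some factor. -/
theorem isTamePrime_iff_exists_single_one_notMem {S : Type*} [DecidableEq S] {R : S → Type*}
    [∀ i, CommRing (R i)] {P : Ideal (Π i, R i)} (hP : P.IsPrime) :
    IsTamePrime R P ↔ ∃ k, (Pi.single k 1 : Π i, R i) ∉ P := by
  constructor
  · rintro ⟨k, p, hp, rfl⟩
    refine ⟨k, fun h ↦ hp.one_notMem ?_⟩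
    simpa [Ideal.mem_comap] using h
  · rintro ⟨k, hk⟩
    have hker := ker_evalRingHom_le_of_single_one_notMem hP hk
    have hsurj : Function.Surjective (Pi.evalRingHom R k) := Function.surjective_eval k
    refine ⟨k, P.map (Pi.evalRingHom R k), Ideal.map_isPrime_of_surjective hsurj hker, ?_⟩
    rw [Ideal.comap_map_of_surjective' _ hsurj, sup_eq_left.mpr hker]

/-- The set of tame primes of `R = Π i, R i` equals the union over `k ∈ S` of the basic open
sets `D(e_k)` where `e_k` is the `k`-th unit idempotent; in particular it is an open subset of
`Spec(R)`. -/
theorem tamePrimes_eq_iUnion_basicOpen_and_isOpen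
    {S : Type*} [DecidableEq S] (R : S → Type*) [∀ i, CommRing (R i)]
    [∀ i, Nontrivial (R i)] :
    ({P : PrimeSpectrum (Π i, R i) | IsTamePrime R P.asIdeal} =
      ⋃ k : S, (PrimeSpectrum.basicOpen (Pi.single k 1 : Π i, R i) :
        Set (PrimeSpectrum (Π i, R i)))) ∧
    IsOpen {P : PrimeSpectrum (Π i, R i) | IsTamePrime R P.asIdeal} := by
  have h : {P : PrimeSpectrum (Π i, R i) | IsTamePrime R P.asIdeal} =
      ⋃ k : S, (PrimeSpectrum.basicOpen (Pi.single k 1 : Π i, R i) :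
        Set (PrimeSpectrum (Π i, R i))) := by
    ext P
    simp [isTamePrime_iff_exists_single_one_notMem P.isPrime]
  refine ⟨h, ?_⟩
  rw [h]
  exact isOpen_iUnion fun k ↦ (PrimeSpectrum.basicOpen _).isOpen
end

section
/- Let (R_i)_{i∈S} be a family of nonzero commutative rings and R = ∏_{i∈S} R_i. If the index set S is infinite, then the set of tame primes of R is not a quasi-compact subset of Spec(R); in particular it is not an affine open subscheme. -/
/-- If the index set `S` is infinite, then the set of tame primes of `R = Π i, R i` is not a
quasi-compact subset of `Spec(R)`; in particular it is not an affine open subscheme. -/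
theorem not_isCompact_tamePrimes {S : Type*} (R : S → Type*) [∀ i, CommRing (R i)]
    [∀ i, Nontrivial (R i)] [Infinite S] :
    ¬ IsCompact {P : PrimeSpectrum (Π i, R i) | IsTamePrime R P.asIdeal} := by
  classical
  intro hcompact
  obtain ⟨t, ht⟩ := hcompact.elim_finite_subcover
    (fun k : S ↦ (PrimeSpectrum.basicOpen (Pi.single k (1 : R k)) :
      Set (PrimeSpectrum (Π i, R i))))
    (fun _ ↦ PrimeSpectrum.isOpen_basicOpen) (by
      rintro P ⟨k, p, hp, hP⟩
      refine Set.mem_iUnion.2 ⟨k, ?_⟩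
      simpa [PrimeSpectrum.mem_basicOpen, hP] using p.ne_top_iff_one.1 hp.ne_top)
  obtain ⟨j, hj⟩ := Infinite.exists_notMem_finset t
  obtain ⟨m, hm⟩ := Ideal.exists_maximal (R j)
  have hprime : m.IsPrime := hm.isPrime
  let P : PrimeSpectrum (Π i, R i) := ⟨m.comap (Pi.evalRingHom R j), inferInstance⟩
  obtain ⟨k, hk, hPk⟩ := Set.mem_iUnion₂.1 (ht (show P ∈ _ from ⟨j, m, hprime, rfl⟩))
  have hjk : j ≠ k := fun h ↦ hj (h ▸ hk)
  refine hPk ?_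
  simp [P, Ideal.mem_comap, Pi.single_eq_of_ne hjk]
end

section
/- Let (R_i)_{i∈S} be a family of nonzero commutative rings and R = ∏_{i∈S} R_i. A prime ideal P of R is a wild prime if and only if the direct sum ideal ⊕_{i∈S} R_i is contained in P; equivalently, P is wild if and only if e_k ∈ P for all k ∈ S. -/
/-- A prime ideal of a direct product ring is *wild* if it is not tame. -/
def IsWildPrime {S : Type*} (R : S → Type*) [∀ i, CommRing (R i)]
    (P : Ideal (Π i, R i)) : Prop :=
  P.IsPrime ∧ ¬ IsTamePrime R P

/-- The direct sum ideal `⊕ i, R i` of the product ring `Π i, R i`, consisting of all elements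
of finite support. -/
def directSumIdeal {S : Type*} (R : S → Type*) [∀ i, CommRing (R i)] :
    Ideal (Π i, R i) where
  carrier := {r : Π i, R i | {i | r i ≠ 0}.Finite}
  zero_mem' := by
    show ({i | (0 : Π i, R i) i ≠ 0}).Finite
    simp only [Pi.zero_apply, ne_eq, not_true_eq_false, Set.setOf_false]
    exact Set.finite_empty
  add_mem' := by
    intro a b ha hb
    have ha' : ({i | a i ≠ 0}).Finite := ha
    have hb' : ({i | b i ≠ 0}).Finite := hb
    show ({i | (a + b) i ≠ 0}).Finite
    refine (ha'.union hb').subset fun k hk => ?_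
    by_contra hc
    simp only [Set.mem_union, Set.mem_setOf_eq, not_or, not_not] at hc
    exact hk (by simp [Pi.add_apply, hc.1, hc.2])
  smul_mem' := by
    intro c x hx
    have hx' : ({i | x i ≠ 0}).Finite := hx
    show ({i | (c • x) i ≠ 0}).Finite
    refine hx'.subset fun k hk => ?_
    simp only [Set.mem_setOf_eq] at hk ⊢
    intro h
    exact hk (by show c k * x k = 0; rw [h, mul_zero])

/-- The direct sum ideal lies in an ideal `I` exactly when `I` contains all the idempotents
`Pi.single k 1`. -/
theorem directSumIdeal_le_iff {S : Type*} [DecidableEq S] (R : S → Type*)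
    [∀ i, CommRing (R i)] (I : Ideal (Π i, R i)) :
    directSumIdeal R ≤ I ↔ ∀ k : S, Pi.single k 1 ∈ I := by
  constructor
  · intro h k
    apply h
    show ({i | (Pi.single k 1 : Π i, R i) i ≠ 0}).Finite
    refine (Set.finite_singleton k).subset fun i hi => ?_
    by_contra hik
    exact hi (Pi.single_eq_of_ne hik 1)
  · intro h x hx
    have hfin : ({i | x i ≠ 0}).Finite := hx
    have hsum : x = ∑ k ∈ hfin.toFinset, x * Pi.single k 1 := by
      ext i
      rw [← Finset.mul_sum, Pi.mul_apply, Finset.sum_apply, Finset.sum_pi_single]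
      by_cases hi : x i = 0 <;> simp [hi]
    rw [hsum]
    exact I.sum_mem fun k _ => I.mul_mem_left x (h k)

/-- A prime ideal is tame exactly when it misses one of the idempotents `Pi.single k 1`. -/
theorem isTamePrime_iff_exists_single_notMem {S : Type*} [DecidableEq S] (R : S → Type*)
    [∀ i, CommRing (R i)] (P : Ideal (Π i, R i)) (hP : P.IsPrime) :
    IsTamePrime R P ↔ ∃ k : S, Pi.single k 1 ∉ P := by
  constructor
  · rintro ⟨k, p, hp, rfl⟩
    refine ⟨k, fun h => hp.one_notMem ?_⟩
    simpa [Ideal.mem_comap] using h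
  · rintro ⟨k, hk⟩
    have hsurj : Function.Surjective (Pi.evalRingHom R k) := Function.surjective_eval k
    have hker : RingHom.ker (Pi.evalRingHom R k) ≤ P := by
      intro x hx
      have hxk : x k = 0 := hx
      have hmul : x * Pi.single k 1 = 0 := by
        ext i
        obtain rfl | hik := eq_or_ne i k
        · simp [hxk]
        · simp [hik]
      exact (hP.mem_or_mem (hmul ▸ P.zero_mem)).resolve_right hk
    refine ⟨k, P.map (Pi.evalRingHom R k), Ideal.map_isPrime_of_surjective hsurj hker, ?_⟩
    rw [Ideal.comap_map_of_surjective' _ hsurj, sup_eq_left.mpr hker]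

/-- A prime ideal `P` of `R = Π i, R i` is wild iff it contains the direct sum ideal
`⊕ i, R i`; equivalently, iff `e_k ∈ P` for every `k ∈ S`. -/
theorem isWildPrime_iff_directSum_le {S : Type*} [DecidableEq S] (R : S → Type*)
    [∀ i, CommRing (R i)] [∀ i, Nontrivial (R i)]
    (P : Ideal (Π i, R i)) (hP : P.IsPrime) :
    (IsWildPrime R P ↔ directSumIdeal R ≤ P) ∧
    (IsWildPrime R P ↔ ∀ k : S, Pi.single k 1 ∈ P) := by
  have hwild : IsWildPrime R P ↔ ∀ k : S, Pi.single k 1 ∈ P := by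
    simp [IsWildPrime, hP, isTamePrime_iff_exists_single_notMem R P hP]
  exact ⟨hwild.trans (directSumIdeal_le_iff R P).symm, hwild⟩
end

section
/- Let (R_i)_{i∈S} be a family of nonzero commutative rings and R = ∏_{i∈S} R_i. If the index set S is infinite, then the set of wild primes of R is not an open subset of Spec(R). -/
theorem mem_range_sigmaToPi_iff_isTamePrime {S : Type*} (R : S → Type*) [∀ i, CommRing (R i)]
    (P : PrimeSpectrum (Π i, R i)) :
    P ∈ Set.range (PrimeSpectrum.sigmaToPi R) ↔ IsTamePrime R P.asIdeal := by
  constructor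
  · rintro ⟨⟨i, p⟩, rfl⟩
    exact ⟨i, p.asIdeal, p.isPrime, rfl⟩
  · rintro ⟨i, p, hp, h⟩
    exact ⟨⟨i, ⟨p, hp⟩⟩, PrimeSpectrum.ext h.symm⟩

/-- A clopen subset of the spectrum of a product ring that contains every prime pulled back
from a factor is the whole spectrum. -/
theorem eq_univ_of_isClopen_of_range_sigmaToPi_subset {S : Type*} (R : S → Type*)
    [∀ i, CommRing (R i)] {T : Set (PrimeSpectrum (Π i, R i))} (hT : IsClopen T)
    (h : Set.range (PrimeSpectrum.sigmaToPi R) ⊆ T) : T = Set.univ := by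
  obtain ⟨e, he, rfl⟩ := PrimeSpectrum.isClopen_iff.mp hT
  have he_one : e = 1 := by
    funext i
    have hu : IsUnit (e i) := by
      by_contra hn
      obtain ⟨m, hm, hem⟩ := exists_max_ideal_of_mem_nonunits hn
      exact h ⟨⟨i, ⟨m, hm.isPrime⟩⟩, rfl⟩ hem
    exact hu.mul_eq_left.mp (congrFun he i)
  simp [he_one]

/-- If the index set `S` is infinite, then the set of wild primes of `R = Π i, R i` is not an
open subset of `Spec(R)`. -/
theorem not_isOpen_wildPrimes {S : Type*} (R : S → Type*) [∀ i, CommRing (R i)]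
    [∀ i, Nontrivial (R i)] [Infinite S] :
    ¬ IsOpen {P : PrimeSpectrum (Π i, R i) | IsWildPrime R P.asIdeal} := by
  intro hW
  have hcompl : {P : PrimeSpectrum (Π i, R i) | IsWildPrime R P.asIdeal} =
      (Set.range (PrimeSpectrum.sigmaToPi R))ᶜ := by
    ext P
    rw [Set.mem_compl_iff, mem_range_sigmaToPi_iff_isTamePrime]
    exact and_iff_right P.isPrime
  rw [hcompl, isOpen_compl_iff] at hW
  exact PrimeSpectrum.sigmaToPi_not_surjective_of_infinite R <| Set.range_eq_univ.mp <|
    eq_univ_of_isClopen_of_range_sigmaToPi_subset R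
      ⟨hW, (PrimeSpectrum.isOpenEmbedding_sigmaToPi R).isOpen_range⟩ subset_rfl
end

section
/- Let (R_i)_{i∈S} be a family of nonzero commutative rings, R = ∏_{i∈S} R_i, and for each i ∈ S fix a prime ideal p_i of R_i. For an ultrafilter F on S define I_F = {a = (a_i) ∈ R : {i ∈ S : a_i ∈ p_i} ∈ F}. Then: (1) I_F is a prime ideal of R; (2) the assignment F ↦ I_F is injective on ultrafilters of S; (3) I_F is a wild prime of R if and only if F is a non-principal ultrafilter (if F is the principal ultrafilter at k, then I_F = π_k^{-1}(p_k)). -/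
/-- The ideal of all `a` in a product ring whose coordinates lie in the ideals `p i` for
`F`-almost all `i`. -/
def Ideal.eventuallyMem {S : Type*} {R : S → Type*} [∀ i, CommRing (R i)]
    (p : ∀ i, Ideal (R i)) (F : Filter S) : Ideal (Π i, R i) where
  carrier := {a | {i | a i ∈ p i} ∈ F}
  add_mem' ha hb := by
    filter_upwards [ha, hb] with i hai hbi using (p i).add_mem hai hbi
  zero_mem' := Filter.Eventually.of_forall fun i => (p i).zero_mem
  smul_mem' c _ ha := by
    filter_upwards [ha] with i hai using (p i).mul_mem_left (c i) hai

theorem Ideal.mem_eventuallyMem {S : Type*} {R : S → Type*} [∀ i, CommRing (R i)]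
    {p : ∀ i, Ideal (R i)} {F : Filter S} {a : Π i, R i} :
    a ∈ Ideal.eventuallyMem p F ↔ ∀ᶠ i in F, a i ∈ p i :=
  Iff.rfl

theorem Ideal.isPrime_eventuallyMem {S : Type*} {R : S → Type*} [∀ i, CommRing (R i)]
    {p : ∀ i, Ideal (R i)} (hp : ∀ i, (p i).IsPrime) (F : Ultrafilter S) :
    (Ideal.eventuallyMem p (F : Filter S)).IsPrime where
  ne_top' := by
    rw [Ideal.ne_top_iff_one, Ideal.mem_eventuallyMem]
    intro h
    obtain ⟨i, hi⟩ := h.exists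
    exact (Ideal.ne_top_iff_one _).1 (hp i).ne_top hi
  mem_or_mem' {a b} h := by
    simp only [Ideal.mem_eventuallyMem] at h ⊢
    rw [← Ultrafilter.eventually_or]
    exact h.mono fun i hi => (hp i).mem_or_mem hi

theorem Ideal.setOf_ite_mem {S : Type*} {R : S → Type*} [∀ i, CommRing (R i)]
    {p : ∀ i, Ideal (R i)} (hp : ∀ i, p i ≠ ⊤) (T : Set S) [DecidablePred (· ∈ T)] :
    {i | (if i ∈ T then 0 else 1 : R i) ∈ p i} = T := by
  ext i
  by_cases hi : i ∈ T
  · simp [hi]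
  · simpa [hi] using (Ideal.ne_top_iff_one _).1 (hp i)

theorem Ultrafilter.eq_pure_of_singleton_mem {S : Type*} {F : Ultrafilter S} {k : S}
    (h : {k} ∈ F) : F = pure k :=
  Ultrafilter.coe_le_coe.1 (Filter.le_pure_iff.2 h)


/-- For each `i ∈ S` fix a prime ideal `p i` of `R i`, and for an ultrafilter `F` on `S` let
`I_F = {a | {i | a i ∈ p i} ∈ F}`. Then: (1) `I_F` is a prime ideal of `Π i, R i`;
(2) `F ↦ I_F` is injective; (3) `I_F` is a wild prime iff `F` is non-principal, and if
`F = pure k` then `I_F = π_k⁻¹(p k)`. -/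
theorem ultrafilter_wild_primes {S : Type*} (R : S → Type*) [∀ i, CommRing (R i)]
    [∀ i, Nontrivial (R i)] (p : ∀ i, Ideal (R i)) (hp : ∀ i, (p i).IsPrime) :
    (∀ F : Ultrafilter S, ∃ I : Ideal (Π i, R i), I.IsPrime ∧
        (I : Set (Π i, R i)) = {a | {i | a i ∈ p i} ∈ F}) ∧
    (∀ F G : Ultrafilter S,
        {a : Π i, R i | {i | a i ∈ p i} ∈ F} = {a : Π i, R i | {i | a i ∈ p i} ∈ G} →
        F = G) ∧
    (∀ (F : Ultrafilter S) (I : Ideal (Π i, R i)),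
        (I : Set (Π i, R i)) = {a | {i | a i ∈ p i} ∈ F} →
        (IsWildPrime R I ↔ ¬ ∃ k : S, F = pure k) ∧
        (∀ k : S, F = pure k → I = (p k).comap (Pi.evalRingHom R k))) := by
  have hp' i := (hp i).ne_top
  refine ⟨fun F => ⟨Ideal.eventuallyMem p F, Ideal.isPrime_eventuallyMem hp F, rfl⟩, ?_, ?_⟩
  · classical
    intro F G h
    ext T
    have hT := Set.ext_iff.1 h fun i => if i ∈ T then 0 else 1
    simpa only [Set.mem_ofPred_eq, Ideal.setOf_ite_mem hp'] using hT
  · intro F I hI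
    have hpure : ∀ k : S, F = pure k → I = (p k).comap (Pi.evalRingHom R k) := by
      rintro k rfl
      ext a
      exact Set.ext_iff.1 hI a
    refine ⟨⟨?_, fun hF => ⟨?_, ?_⟩⟩, hpure⟩
    · rintro ⟨-, hwild⟩ ⟨k, hk⟩
      exact hwild ⟨k, p k, hp k, hpure k hk⟩
    · have hI' : I = Ideal.eventuallyMem p F := SetLike.coe_injective hI
      exact hI' ▸ Ideal.isPrime_eventuallyMem hp F
    · classical
      rintro ⟨k, q, -, hIq⟩
      refine hF ⟨k, Ultrafilter.eq_pure_of_singleton_mem ?_⟩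
      have hmem : (fun i => if i ∈ ({k} : Set S) then 0 else 1 : Π i, R i) ∈ I := by
        simp [hIq, Ideal.mem_comap]
      have hF' := Set.ext_iff.1 hI _ |>.1 hmem
      simpa only [Set.mem_ofPred_eq, Ideal.setOf_ite_mem hp'] using hF'
end

section
/- Let p be a prime number and R = ∏_{n∈ℕ} ℤ/p^{n+1}ℤ. Then there exists a wild prime ideal P of R which is not of the form I_F = {a ∈ R : {n ∈ ℕ : a_n is not a unit in ℤ/p^{n+1}ℤ} ∈ F} for any ultrafilter F on ℕ. (Indeed, the element a with a_n = p + p^{n+1}ℤ for all n belongs to every I_F but is not nilpotent in R, hence lies outside some prime ideal, which is necessarily wild and not of the form I_F.) -/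
theorem ZMod.isNilpotent_natCast_pow_succ (p n : ℕ) :
    IsNilpotent (p : ZMod (p ^ (n + 1))) :=
  ⟨n + 1, by rw [← Nat.cast_pow, ZMod.natCast_self]⟩

theorem ZMod.not_isUnit_natCast_pow_succ {p : ℕ} (hp : p.Prime) (n : ℕ) :
    ¬ IsUnit (p : ZMod (p ^ (n + 1))) := by
  have : Fact (1 < p ^ (n + 1)) := ⟨Nat.one_lt_pow n.succ_ne_zero hp.one_lt⟩
  exact (ZMod.isNilpotent_natCast_pow_succ p n).not_isUnit

theorem ZMod.not_isNilpotent_natCast_pi {p : ℕ} (hp : p.Prime) :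
    ¬ IsNilpotent (fun n : ℕ => (p : ZMod (p ^ (n + 1)))) := by
  rintro ⟨m, hm⟩
  have h : (p : ZMod (p ^ (m + 1))) ^ m = 0 := congrFun hm m
  rw [← Nat.cast_pow, ZMod.natCast_eq_zero_iff, Nat.pow_dvd_pow_iff_le_right hp.one_lt] at h
  omega

theorem IsTamePrime.mem_of_forall_isNilpotent {S : Type*} {R : S → Type*}
    [∀ i, CommRing (R i)] {P : Ideal (Π i, R i)} (hP : IsTamePrime R P) {a : Π i, R i}
    (ha : ∀ i, IsNilpotent (a i)) : a ∈ P := by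
  obtain ⟨k, q, hq, rfl⟩ := hP
  exact nilpotent_iff_mem_prime.mp (ha k) q hq

/-- For a prime number `p` and `R = Π n, ℤ/p^(n+1)ℤ`, there exists a wild prime `P` of `R`
which is not of the form `I_F = {a | {n | a n is not a unit} ∈ F}` for any ultrafilter `F`
on `ℕ`. -/
theorem exists_wildPrime_not_of_ultrafilter (p : ℕ) (hp : p.Prime) :
    ∃ P : Ideal (Π n : ℕ, ZMod (p ^ (n + 1))),
      IsWildPrime (fun n : ℕ => ZMod (p ^ (n + 1))) P ∧
      ∀ F : Ultrafilter ℕ,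
        (P : Set (Π n : ℕ, ZMod (p ^ (n + 1)))) ≠ {a | {n : ℕ | ¬ IsUnit (a n)} ∈ F} := by
  have h := ZMod.not_isNilpotent_natCast_pi hp
  rw [nilpotent_iff_mem_prime] at h
  push Not at h
  obtain ⟨P, hP, hmem⟩ := h
  refine ⟨P, ⟨hP, fun hT => hmem (hT.mem_of_forall_isNilpotent
    (ZMod.isNilpotent_natCast_pow_succ p))⟩, fun F hF => hmem ?_⟩
  rw [← SetLike.mem_coe, hF]
  exact Filter.Eventually.of_forall (ZMod.not_isUnit_natCast_pow_succ hp)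
end

section
/- Let (R_i)_{i∈S} be a family of nonzero commutative rings and R = ∏_{i∈S} R_i. Then R has a wild prime if and only if the index set S is infinite; moreover, if S is infinite, then the set of wild primes of R has cardinality at least 2^(2^|S|). -/
universe u

open scoped Classical in
/-- Sets indexed by `Set S` on a set of the cardinality of `S` (Hausdorff's independent family). -/
def hausdorffSet {S : Type*} (A : Set S) : Set (Finset S × Finset (Finset S)) :=
  {t | t.1.filter (· ∈ A) ∈ t.2}

open Filter in
open scoped Classical in
/-- A filter containing `hausdorffSet A` for `A ∈ 𝒜` and its complement for `A ∉ 𝒜`. -/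
noncomputable def hausdorffFilter {S : Type*} (𝒜 : Set (Set S)) :
    Filter (Finset S × Finset (Finset S)) :=
  map (fun q : Finset (Set S) × Finset S =>
    (q.2, (q.1.filter (· ∈ 𝒜)).image fun A => q.2.filter (· ∈ A))) (atTop.curry atTop)

instance hausdorffFilter_neBot {S : Type*} (𝒜 : Set (Set S)) : (hausdorffFilter 𝒜).NeBot := by
  refine Filter.NeBot.map (Filter.forall_mem_nonempty_iff_neBot.1 fun X hX => ?_) _
  obtain ⟨K, hK⟩ := (Filter.mem_curry_iff.1 hX).exists
  obtain ⟨F, hF⟩ := hK.exists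
  exact ⟨(K, F), hF⟩

theorem hausdorffSet_mem_hausdorffFilter {S : Type*} {𝒜 : Set (Set S)} {A : Set S}
    (hA : A ∈ 𝒜) : hausdorffSet A ∈ hausdorffFilter 𝒜 := by
  classical
  refine Filter.mem_map.2 (Filter.mem_curry_iff.2 ?_)
  filter_upwards [Filter.eventually_ge_atTop {A}] with K hK
  refine Filter.Eventually.of_forall fun F => ?_
  simp only [hausdorffSet, Set.mem_preimage, Set.mem_ofPred_eq, Finset.mem_image,
    Finset.mem_filter]
  exact ⟨A, ⟨Finset.singleton_subset_iff.1 hK, hA⟩, Finset.filter_congr_decidable ..⟩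

theorem compl_hausdorffSet_mem_hausdorffFilter {S : Type*} {𝒜 : Set (Set S)} {B : Set S}
    (hB : B ∉ 𝒜) : (hausdorffSet B)ᶜ ∈ hausdorffFilter 𝒜 := by
  classical
  refine Filter.mem_map.2 (Filter.mem_curry_iff.2 (Filter.Eventually.of_forall fun K => ?_))
  have separate : ∀ A ∈ K, ∀ᶠ F : Finset S in Filter.atTop,
      A ∈ 𝒜 → F.filter (· ∈ A) ≠ F.filter (· ∈ B) := by
    intro A _
    by_cases hA : A ∈ 𝒜
    · have hAB : A ≠ B := fun h => hB (h ▸ hA)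
      obtain ⟨x, hx⟩ : ∃ x, ¬ (x ∈ A ↔ x ∈ B) := by
        by_contra! h
        exact hAB (Set.ext h)
      filter_upwards [Filter.eventually_ge_atTop {x}] with F hF _ h
      have hxF : x ∈ F := Finset.singleton_subset_iff.1 hF
      have := Finset.ext_iff.1 h x
      simp only [Finset.mem_filter, hxF, true_and] at this
      exact hx this
    · exact Filter.Eventually.of_forall fun F h => absurd h hA
  filter_upwards [(Filter.eventually_all_finset K).2 separate] with F hF h
  simp only [hausdorffSet, Set.mem_ofPred_eq, Finset.mem_image, Finset.mem_filter] at h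
  obtain ⟨A, ⟨hAK, hA⟩, h⟩ := h
  refine hF A hAK hA ?_
  convert h

theorem compl_singleton_mem_hausdorffFilter {S : Type*} [Infinite S] (𝒜 : Set (Set S))
    (t : Finset S × Finset (Finset S)) : {t}ᶜ ∈ hausdorffFilter 𝒜 := by
  refine Filter.mem_map.2 (Filter.mem_curry_iff.2 (Filter.Eventually.of_forall fun K => ?_))
  obtain ⟨x, hx⟩ := Infinite.exists_notMem_finset t.1
  filter_upwards [Filter.eventually_ge_atTop {x}] with F hF h
  exact hx (congrArg Prod.fst h ▸ Finset.singleton_subset_iff.1 hF)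

/-- On an infinite type there are at least `2 ^ 2 ^ |S|` nonprincipal ultrafilters. -/
theorem exists_injective_nonprincipal_ultrafilter (S : Type*) [Infinite S] :
    ∃ f : Set (Set S) → Ultrafilter S, f.Injective ∧ ∀ 𝒜 k, {k}ᶜ ∈ f 𝒜 := by
  have hcard : Cardinal.mk (Finset S × Finset (Finset S)) = Cardinal.mk S := by
    simp [Cardinal.mk_finset_of_infinite]
  obtain ⟨e⟩ := Cardinal.eq.1 hcard
  refine ⟨fun 𝒜 => (Ultrafilter.of (hausdorffFilter 𝒜)).map e, fun 𝒜 ℬ h => ?_, fun 𝒜 k => ?_⟩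
  · have hU : Ultrafilter.of (hausdorffFilter 𝒜) = Ultrafilter.of (hausdorffFilter ℬ) := by
      ext X
      have := congrArg (e.symm ⁻¹' X ∈ ·) h
      simpa [Ultrafilter.mem_map, ← Set.preimage_comp] using this
    have mem_iff (𝒞 : Set (Set S)) (A : Set S) :
        hausdorffSet A ∈ Ultrafilter.of (hausdorffFilter 𝒞) ↔ A ∈ 𝒞 := by
      refine ⟨fun hA => ?_, fun hA => Ultrafilter.of_le _ (hausdorffSet_mem_hausdorffFilter hA)⟩
      by_contra hA'
      exact Ultrafilter.compl_mem_iff_notMem.1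
        (Ultrafilter.of_le _ (compl_hausdorffSet_mem_hausdorffFilter hA')) hA
    ext A
    rw [← mem_iff 𝒜, hU, mem_iff]
  · have hk : e ⁻¹' {k}ᶜ = {e.symm k}ᶜ := by
      ext t
      simp [Equiv.eq_symm_apply]
    rw [Ultrafilter.mem_map, hk]
    exact Ultrafilter.of_le _ (compl_singleton_mem_hausdorffFilter 𝒜 _)

/-- The ideal of elements lying in `p i` for almost all `i` with respect to an ultrafilter. -/
def ultrafilterIdeal {S : Type*} {R : S → Type*} [∀ i, CommRing (R i)]
    (p : ∀ i, Ideal (R i)) (U : Ultrafilter S) : Ideal (Π i, R i) where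
  carrier := {x | ∀ᶠ i in U, x i ∈ p i}
  zero_mem' := Filter.Eventually.of_forall fun i => (p i).zero_mem
  add_mem' hx hy := by
    filter_upwards [hx, hy] with i hxi hyi using (p i).add_mem hxi hyi
  smul_mem' c x hx := by
    filter_upwards [hx] with i hxi using (p i).mul_mem_left (c i) hxi

section ultrafilterIdeal

variable {S : Type*} {R : S → Type*} [∀ i, CommRing (R i)] (p : ∀ i, Ideal (R i))

theorem mem_ultrafilterIdeal {U : Ultrafilter S} {x : Π i, R i} :
    x ∈ ultrafilterIdeal p U ↔ ∀ᶠ i in U, x i ∈ p i :=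
  Iff.rfl

theorem ultrafilterIdeal_isPrime [hp : ∀ i, (p i).IsPrime] (U : Ultrafilter S) :
    (ultrafilterIdeal p U).IsPrime := by
  refine Ideal.isPrime_iff.2 ⟨(Ideal.ne_top_iff_one _).2 fun h => ?_, fun {x y} hxy => ?_⟩
  · obtain ⟨i, hi⟩ := ((mem_ultrafilterIdeal p).1 h).exists
    exact (Ideal.ne_top_iff_one _).1 (hp i).ne_top hi
  · simp only [mem_ultrafilterIdeal] at hxy ⊢
    rw [← Ultrafilter.eventually_or]
    filter_upwards [hxy] with i hi using (hp i).mem_or_mem hi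

theorem ultrafilterIdeal_injective [hp : ∀ i, (p i).IsPrime] :
    Function.Injective (ultrafilterIdeal p) := by
  classical
  have indicator_mem (U : Ultrafilter S) (X : Set S) :
      (fun i => if i ∈ X then (0 : R i) else 1) ∈ ultrafilterIdeal p U ↔ X ∈ U := by
    rw [mem_ultrafilterIdeal]
    refine Filter.eventually_congr (p := fun i => _) (q := (· ∈ X))
      (Filter.Eventually.of_forall fun i => ?_)
    by_cases hi : i ∈ X
    · simp [hi]
    · simpa [hi] using (Ideal.ne_top_iff_one _).1 (hp i).ne_top
  intro U V h
  ext X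
  rw [← indicator_mem, h, indicator_mem]

theorem ultrafilterIdeal_isWildPrime [∀ i, (p i).IsPrime] {U : Ultrafilter S}
    (hU : ∀ k, {k}ᶜ ∈ U) : IsWildPrime R (ultrafilterIdeal p U) := by
  classical
  refine ⟨ultrafilterIdeal_isPrime p U, ?_⟩
  rintro ⟨k, q, hq, h⟩
  have hmem : Pi.single k (1 : R k) ∈ ultrafilterIdeal p U := by
    rw [mem_ultrafilterIdeal]
    filter_upwards [hU k] with i hi
    rw [Pi.single_eq_of_ne hi]
    exact (p i).zero_mem
  rw [h, Ideal.mem_comap, Pi.evalRingHom_apply, Pi.single_eq_same] at hmem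
  exact (Ideal.ne_top_iff_one _).1 hq.ne_top hmem

end ultrafilterIdeal

theorem isTamePrime_of_finite {S : Type*} [Finite S] {R : S → Type*} [∀ i, CommRing (R i)]
    {P : Ideal (Π i, R i)} (hP : P.IsPrime) : IsTamePrime R P := by
  obtain ⟨⟨k, q⟩, hq⟩ := (PrimeSpectrum.sigmaToPi_bijective R).2 ⟨P, hP⟩
  exact ⟨k, q.asIdeal, q.isPrime, (congrArg PrimeSpectrum.asIdeal hq).symm⟩

/-- `R = Π i, R i` has a wild prime iff the index set `S` is infinite; moreover if `S` is
infinite then the set of wild primes of `R` has cardinality at least `2 ^ (2 ^ |S|)`. -/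
theorem exists_wildPrime_iff_infinite {S : Type u} (R : S → Type u)
    [∀ i, CommRing (R i)] [∀ i, Nontrivial (R i)] :
    ((∃ P : Ideal (Π i, R i), IsWildPrime R P) ↔ Infinite S) ∧
    (Infinite S →
      (2 : Cardinal.{u}) ^ ((2 : Cardinal.{u}) ^ Cardinal.mk S) ≤ Cardinal.mk {P : Ideal (Π i, R i) // IsWildPrime R P}) := by
  have card_le (hS : Infinite S) : (2 : Cardinal.{u}) ^ ((2 : Cardinal.{u}) ^ Cardinal.mk S) ≤
      Cardinal.mk {P : Ideal (Π i, R i) // IsWildPrime R P} := by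
    obtain ⟨f, hf, hfree⟩ := exists_injective_nonprincipal_ultrafilter S
    choose p hp using fun i => Ideal.exists_maximal (R i)
    have hprime (i : S) : (p i).IsPrime := (hp i).isPrime
    rw [← Cardinal.mk_set, ← Cardinal.mk_set]
    refine Cardinal.mk_le_of_injective
      (f := fun 𝒜 => ⟨ultrafilterIdeal p (f 𝒜), ultrafilterIdeal_isWildPrime p (hfree 𝒜)⟩) ?_
    intro 𝒜 ℬ h
    exact hf (ultrafilterIdeal_injective p (congrArg Subtype.val h))
  refine ⟨⟨fun ⟨P, hP, hwild⟩ => ?_, fun hS => ?_⟩, card_le⟩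
  · by_contra hS
    have : Finite S := not_infinite_iff_finite.1 hS
    exact hwild (isTamePrime_of_finite hP)
  · have hpos := (Cardinal.power_pos (2 ^ Cardinal.mk S) two_pos).trans_le (card_le hS)
    obtain ⟨P⟩ := Cardinal.mk_ne_zero_iff.1 hpos.ne'
    exact ⟨P.1, P.2⟩
end

section
/- Let (R_k)_{k∈S} be a family of commutative local rings indexed by an infinite set S and let R = ∏_{k∈S} R_k. Then the set of maximal wild primes of R (ideals of R that are both maximal ideals of R and wild primes) has cardinality exactly 2^(2^|S|). -/
universe u

open Filter in
/-- An infinite type `S` carries a family of subsets indexed by `Set S` that is independent modulo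
finite sets: every prescription of which members to contain is realised by a filter finer than the
cofinite filter. -/
theorem exists_independent_family (S : Type u) [Infinite S] :
    ∃ X : Set S → Set S, ∀ f : Set (Set S), ∃ F : Filter S, F.NeBot ∧ F ≤ cofinite ∧
      ∀ A, ∀ᶠ k in F, (k ∈ X A ↔ A ∈ f) := by
  classical
  have hcard : Cardinal.mk (Finset S × Finset (Finset S)) = Cardinal.mk S := by
    simp [Cardinal.mk_finset_of_infinite, Cardinal.mul_eq_self (Cardinal.aleph0_le_mk S)]
  obtain ⟨e⟩ := Cardinal.eq.1 hcard
  have hw : ∀ A B : Set S, ∃ x, A ≠ B → ¬(x ∈ A ↔ x ∈ B) := by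
    intro A B
    by_cases h : A = B
    · exact ⟨Classical.arbitrary S, fun h' => (h' h).elim⟩
    · by_contra! hc
      exact h (Set.ext fun x => (hc x).2)
  choose w hw using hw
  refine ⟨fun A => {k | (e.symm k).1.filter (· ∈ A) ∈ (e.symm k).2}, fun f => ?_⟩
  let D : Finset (Set S) × Finset S → Finset S :=
    fun p => (p.1 ×ˢ p.1).image (fun q => w q.1 q.2) ∪ p.2
  let t : Finset (Set S) × Finset S → Finset S × Finset (Finset S) :=
    fun p => (D p, (p.1.filter (· ∈ f)).image fun A => (D p).filter (· ∈ A))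
  refine ⟨map (fun p => e (t p)) atTop, inferInstance, ?_, fun A => ?_⟩
  · rw [le_cofinite_iff_compl_singleton_mem]
    intro k
    obtain ⟨x, hx⟩ := Infinite.exists_notMem_finset (e.symm k).1
    rw [mem_map]
    filter_upwards [eventually_ge_atTop ((∅, {x}) : Finset (Set S) × Finset S)] with p hp
    rintro rfl
    apply hx
    have : x ∈ p.2 := hp.2 (Finset.mem_singleton_self x)
    simp [t, D, this]
  · rw [eventually_map]
    filter_upwards [eventually_ge_atTop (({A}, ∅) : Finset (Set S) × Finset S)] with p hp
    have hA : A ∈ p.1 := hp.1 (Finset.mem_singleton_self A)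
    simp only [Equiv.symm_apply_apply, t, Finset.mem_image, Finset.mem_filter]
    constructor
    · rintro ⟨B, ⟨hB, hBf⟩, h⟩
      by_cases hBA : B = A
      · exact hBA ▸ hBf
      · have hD : w B A ∈ D p := Finset.mem_union_left _
          (Finset.mem_image.2 ⟨(B, A), Finset.mem_product.2 ⟨hB, hA⟩, rfl⟩)
        have := Finset.ext_iff.1 h (w B A)
        simp only [Finset.mem_filter, hD, true_and] at this
        exact (hw B A hBA this).elim
    · exact fun h => ⟨A, ⟨hA, h⟩, rfl⟩

open Classical in
/-- The idempotent of a product ring that is `1` on `A` and `0` elsewhere. -/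
noncomputable def piIdempotent {S : Type*} (R : S → Type*) [∀ i, CommRing (R i)] (A : Set S) :
    Π i, R i :=
  fun i => if i ∈ A then 1 else 0

theorem piIdempotent_mem_of_isUnit {S : Type*} {R : S → Type*} [∀ i, CommRing (R i)]
    {I : Ideal (Π i, R i)} {r : Π i, R i} (hr : r ∈ I) {A : Set S}
    (hA : ∀ i ∈ A, IsUnit (r i)) : piIdempotent R A ∈ I := by
  have : piIdempotent R A = (fun i => piIdempotent R A i * Ring.inverse (r i)) * r := by
    funext i
    by_cases hi : i ∈ A
    · simp [piIdempotent, hi, Ring.inverse_mul_cancel _ (hA i hi)]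
    · simp [piIdempotent, hi]
  rw [this]
  exact I.mul_mem_left _ hr

theorem piIdempotent_add_compl {S : Type*} (R : S → Type*) [∀ i, CommRing (R i)] (A : Set S) :
    piIdempotent R A + piIdempotent R Aᶜ = 1 := by
  funext i
  by_cases hi : i ∈ A <;> simp [piIdempotent, hi]

/-- In a product of local rings, membership in a maximal ideal is decided by idempotents. -/
theorem Ideal.IsMaximal.mem_iff_piIdempotent_mem {S : Type*} {R : S → Type*}
    [∀ i, CommRing (R i)] [∀ i, IsLocalRing (R i)] {P : Ideal (Π i, R i)} (hP : P.IsMaximal)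
    (r : Π i, R i) : r ∈ P ↔ piIdempotent R {i | IsUnit (r i)} ∈ P := by
  refine ⟨fun hr => piIdempotent_mem_of_isUnit hr fun i hi => hi, fun h => ?_⟩
  by_contra hr
  obtain ⟨s, p, hp, hs⟩ := hP.exists_inv hr
  refine hP.ne_top ((Ideal.eq_top_iff_one P).2 ?_)
  rw [← piIdempotent_add_compl R {i | IsUnit (r i)}]
  refine P.add_mem h (piIdempotent_mem_of_isUnit hp fun i hi => ?_)
  have hi' := congrFun hs i
  simp only [Pi.add_apply, Pi.mul_apply, Pi.one_apply] at hi'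
  refine (IsLocalRing.isUnit_or_isUnit_of_add_one hi').resolve_left fun hu => hi ?_
  exact isUnit_of_mul_isUnit_right hu

/-- The ideal of elements of a product of local rings that are non-units along a filter. -/
def Filter.nonunitsIdeal {S : Type*} (F : Filter S) (R : S → Type*) [∀ i, CommRing (R i)]
    [∀ i, IsLocalRing (R i)] : Ideal (Π i, R i) where
  carrier := {r | ∀ᶠ i in F, r i ∈ IsLocalRing.maximalIdeal (R i)}
  zero_mem' := Filter.Eventually.of_forall fun i => Ideal.zero_mem _
  add_mem' ha hb := by
    filter_upwards [ha, hb] with i h₁ h₂ using Ideal.add_mem _ h₁ h₂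
  smul_mem' c r hr := by
    filter_upwards [hr] with i h using Ideal.mul_mem_left _ _ h

theorem Filter.nonunitsIdeal_ne_top {S : Type*} (F : Filter S) [F.NeBot] (R : S → Type*)
    [∀ i, CommRing (R i)] [∀ i, IsLocalRing (R i)] : F.nonunitsIdeal R ≠ ⊤ := by
  intro h
  have h₁ : ∀ᶠ i in F, (1 : Π i, R i) i ∈ IsLocalRing.maximalIdeal (R i) :=
    (Ideal.eq_top_iff_one _).1 h
  obtain ⟨i, hi⟩ := h₁.exists
  exact (IsLocalRing.maximalIdeal.isMaximal (R i)).ne_top ((Ideal.eq_top_iff_one _).2 hi)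

theorem Filter.piIdempotent_mem_nonunitsIdeal {S : Type*} {F : Filter S} {R : S → Type*}
    [∀ i, CommRing (R i)] [∀ i, IsLocalRing (R i)] {A : Set S} (hA : ∀ᶠ i in F, i ∉ A) :
    piIdempotent R A ∈ F.nonunitsIdeal R := by
  filter_upwards [hA] with i hi
  simp [piIdempotent, hi]

theorem not_isTamePrime_of_nonunitsIdeal_le {S : Type*} {F : Filter S} (hF : F ≤ Filter.cofinite)
    {R : S → Type*} [∀ i, CommRing (R i)] [∀ i, IsLocalRing (R i)] {P : Ideal (Π i, R i)}
    (hP : F.nonunitsIdeal R ≤ P) : ¬ IsTamePrime R P := by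
  rintro ⟨k, p, hp, rfl⟩
  have hk : piIdempotent R {k} ∈ F.nonunitsIdeal R :=
    Filter.piIdempotent_mem_nonunitsIdeal (Filter.le_cofinite_iff_compl_singleton_mem.1 hF k)
  have hk' := hP hk
  simp only [Ideal.mem_comap, Pi.evalRingHom_apply, piIdempotent, Set.mem_singleton_iff,
    if_true] at hk'
  exact hp.ne_top ((Ideal.eq_top_iff_one p).2 hk')

/-- If `S` is infinite and each `R k` is a local ring, then the set of maximal wild primes
of `R = Π k, R k` has cardinality `2 ^ (2 ^ |S|)`. -/
theorem card_maximal_wildPrimes {S : Type u} (R : S → Type u) [Infinite S]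
    [∀ k, CommRing (R k)] [∀ k, IsLocalRing (R k)] :
    Cardinal.mk {P : Ideal (Π k, R k) // P.IsMaximal ∧ IsWildPrime R P} =
      (2 : Cardinal.{u}) ^ ((2 : Cardinal.{u}) ^ Cardinal.mk S) := by
  rw [← Cardinal.mk_set, ← Cardinal.mk_set]
  apply le_antisymm
  · refine Cardinal.mk_le_of_injective
      (f := fun P => {A : Set S | piIdempotent R A ∈ P.1}) fun P Q h => Subtype.ext ?_
    ext r
    rw [P.2.1.mem_iff_piIdempotent_mem, Q.2.1.mem_iff_piIdempotent_mem]
    exact Set.ext_iff.1 h {i | IsUnit (r i)}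
  · obtain ⟨X, hX⟩ := exists_independent_family S
    choose F hne hcof hF using hX
    have hM : ∀ f, ∃ M : Ideal (Π k, R k), M.IsMaximal ∧ (F f).nonunitsIdeal R ≤ M := fun f =>
      have := hne f
      Ideal.exists_le_maximal _ ((F f).nonunitsIdeal_ne_top R)
    choose M hmax hle using hM
    have key : ∀ f g A, M f = M g → A ∈ f → A ∈ g := by
      intro f g A h hf
      by_contra hg
      refine (hmax f).ne_top ((Ideal.eq_top_iff_one _).2 ?_)
      rw [← piIdempotent_add_compl R (X A)]
      refine Ideal.add_mem _ (h ▸ hle g (Filter.piIdempotent_mem_nonunitsIdeal ?_))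
        (hle f (Filter.piIdempotent_mem_nonunitsIdeal ?_))
      · filter_upwards [hF g A] with k hk using fun h => hg (hk.1 h)
      · filter_upwards [hF f A] with k hk using fun h => h (hk.2 hf)
    refine Cardinal.mk_le_of_injective (f := fun f =>
      ⟨M f, hmax f, (hmax f).isPrime, not_isTamePrime_of_nonunitsIdeal_le (hcof f) (hle f)⟩) ?_
    intro f g h
    have h' : M f = M g := congrArg Subtype.val h
    exact Set.ext fun A => ⟨key f g A h', key g f A h'.symm⟩
end

section
/- Let (R_k)_{k∈S} be a family of integral domains and R = ∏_{k∈S} R_k. Let U = {r ∈ R : {k ∈ S : r_k = 0} is finite}. If P is a minimal prime of R that is a wild prime (equivalently, a minimal prime containing the direct sum ideal ⊕_{k∈S} R_k), then P ∩ U = ∅. -/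
/-- If each `R k` is an integral domain and `P` is a minimal prime of `R = Π k, R k`
containing the direct sum ideal (i.e. a minimal wild prime), then `P` is disjoint from the
set `U` of elements with cofinite support. -/
theorem minimal_wildPrime_disjoint_cofiniteSupport {S : Type*} (R : S → Type*)
    [∀ k, CommRing (R k)] [∀ k, IsDomain (R k)]
    (P : Ideal (Π k, R k)) (hmin : P ∈ minimalPrimes (Π k, R k))
    (hwild : directSumIdeal R ≤ P) :
    ∀ r : Π k, R k, ({k | r k = 0}).Finite → r ∉ P := by
  classical
  intro r hr hrP
  set d : Π k, R k := fun k => if r k = 0 then 1 else 0 with hd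
  have hdP : d ∈ P := by
    refine hwild (show ({k | d k ≠ 0}).Finite from hr.subset fun k hk => ?_)
    by_contra h
    exact hk (if_neg h)
  have hne : ∀ k, (r + d) k ≠ 0 := by
    intro k
    by_cases h : r k = 0 <;> simp [hd, h]
  obtain ⟨y, hy, hn⟩ := Ideal.exists_mul_mem_of_mem_minimalPrimes hmin (P.add_mem hrP hdP)
  refine hy (funext fun k => ?_)
  have hk : (r + d) k * y k = 0 := congrFun hn k
  exact (mul_eq_zero.mp hk).resolve_left (hne k)
end

section
/- Let (R_k)_{k∈S} be a family of commutative local rings and R = ∏_{k∈S} R_k. Let T be the multiplicative submonoid of R consisting of all r = (r_k) such that {k ∈ S : r_k is a unit in R_k} is cofinite. Let I = ⊕_{k∈S} R_k be the direct sum ideal. Then the quotient ring R/I, with the canonical quotient map R → R/I, is the localization of R at T; that is, the quotient map kills exactly I, sends every element of T to a unit of R/I, and the induced canonical map R/I → T^{-1}R is a ring isomorphism. -/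
/-- The multiplicative submonoid `T` of `Π k, R k` consisting of all elements `r` such that
`r k` is a unit for all but finitely many `k`. -/
def cofiniteUnitsSubmonoid {S : Type*} (R : S → Type*) [∀ k, CommRing (R k)] :
    Submonoid (Π k, R k) where
  carrier := {r : Π k, R k | {k | ¬ IsUnit (r k)}.Finite}
  one_mem' := by
    show ({k | ¬ IsUnit ((1 : Π k, R k) k)}).Finite
    simp only [Pi.one_apply, isUnit_one, not_true_eq_false, Set.setOf_false]
    exact Set.finite_empty
  mul_mem' := by
    intro a b ha hb
    have ha' : ({k | ¬ IsUnit (a k)}).Finite := ha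
    have hb' : ({k | ¬ IsUnit (b k)}).Finite := hb
    show ({k | ¬ IsUnit ((a * b) k)}).Finite
    refine (ha'.union hb').subset fun k hk => ?_
    by_contra hc
    simp only [Set.mem_union, Set.mem_setOf_eq, not_or, not_not] at hc
    exact hk (hc.1.mul hc.2)

/-- An element that is a unit in all but finitely many coordinates becomes a unit modulo the direct
sum ideal. -/
theorem isUnit_mk_directSumIdeal {S : Type*} {R : S → Type*} [∀ k, CommRing (R k)]
    {r : Π k, R k} (hr : r ∈ cofiniteUnitsSubmonoid R) :
    IsUnit (Ideal.Quotient.mk (directSumIdeal R) r) := by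
  have hfin : {k | ¬ IsUnit (r k)}.Finite := hr
  refine IsUnit.of_mul_eq_one (Ideal.Quotient.mk _ fun k => Ring.inverse (r k)) ?_
  rw [← map_mul, ← map_one (Ideal.Quotient.mk (directSumIdeal R)), Ideal.Quotient.eq]
  refine hfin.subset fun k hk hu => hk ?_
  simp [Ring.mul_inverse_cancel _ hu]

/-- Every element of the direct sum ideal is annihilated by an element that is a unit in all but
finitely many coordinates. -/
theorem exists_mul_eq_zero_of_mem_directSumIdeal {S : Type*} {R : S → Type*}
    [∀ k, CommRing (R k)] {x : Π k, R k} (hx : x ∈ directSumIdeal R) :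
    ∃ c ∈ cofiniteUnitsSubmonoid R, c * x = 0 := by
  classical
  have hfin : {k | x k ≠ 0}.Finite := hx
  refine ⟨fun k => if x k = 0 then 1 else 0, hfin.subset fun k hk h0 => hk ?_, ?_⟩
  · simp [h0]
  · ext k
    by_cases h : x k = 0 <;> simp [h]

/-- If each `R k` is a local ring, then `R = Π k, R k` modulo the direct sum ideal
`I = ⊕ k, R k`, together with the canonical quotient map, is the localization of `R` at the
multiplicative set `T` of elements which are units in all but finitely many coordinates:
the quotient map kills exactly `I`, sends `T` to units, and the induced map
`R/I → T⁻¹R` is an isomorphism. -/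
theorem quotient_directSum_isLocalization {S : Type*} (R : S → Type*)
    [∀ k, CommRing (R k)] [∀ k, IsLocalRing (R k)] :
    IsLocalization (cofiniteUnitsSubmonoid R) ((Π k, R k) ⧸ directSumIdeal R) := by
  rw [isLocalization_iff]
  refine ⟨fun y => isUnit_mk_directSumIdeal y.2, fun z => ?_, fun {x y} h => ?_⟩
  · obtain ⟨x, rfl⟩ := Ideal.Quotient.mk_surjective z
    exact ⟨(x, 1), by simp⟩
  · obtain ⟨c, hc, h0⟩ :=
      exists_mul_eq_zero_of_mem_directSumIdeal (Ideal.Quotient.eq.mp h)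
    exact ⟨⟨c, hc⟩, sub_eq_zero.mp (by rw [← mul_sub, h0])⟩
end

section
/- Let (R_k)_{k∈S} be a family of commutative local rings and R = ∏_{k∈S} R_k. Let T = {r ∈ R : {k ∈ S : r_k is a unit in R_k} has finite complement in S}. Then a prime ideal P of R is a wild prime if and only if P ∩ T = ∅. -/
/-- A prime ideal of a product ring which does not contain the idempotent of some coordinate is
tame. -/
theorem isTamePrime_of_single_one_notMem {S : Type*} [DecidableEq S] (R : S → Type*)
    [∀ k, CommRing (R k)] {P : Ideal (Π k, R k)} (hP : P.IsPrime) {k : S}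
    (hk : (Pi.single k 1 : Π k, R k) ∉ P) : IsTamePrime R P := by
  have hsurj : Function.Surjective (Pi.evalRingHom R k) := Function.surjective_eval k
  have hker : RingHom.ker (Pi.evalRingHom R k) ≤ P := by
    intro x hx
    have hxk : x k = 0 := hx
    have hmul : x * Pi.single k 1 = 0 := by
      ext j
      obtain rfl | hj := eq_or_ne j k
      · simp [hxk]
      · simp [hj]
    exact (hP.mem_or_mem (hmul ▸ P.zero_mem)).resolve_right hk
  refine ⟨k, P.map (Pi.evalRingHom R k), Ideal.map_isPrime_of_surjective hsurj hker, ?_⟩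
  rw [Ideal.comap_map_of_surjective _ hsurj]
  exact (sup_eq_left.mpr hker).symm

/-- If each `R k` is a local ring, then a prime ideal `P` of `R = Π k, R k` is a wild prime
iff `P` is disjoint from the multiplicative set `T` of elements which are units in all but
finitely many coordinates. -/
theorem isWildPrime_iff_disjoint_cofiniteUnits {S : Type*} (R : S → Type*)
    [∀ k, CommRing (R k)] [∀ k, IsLocalRing (R k)]
    (P : Ideal (Π k, R k)) (hP : P.IsPrime) :
    IsWildPrime R P ↔ ∀ r : Π k, R k, ({k | ¬ IsUnit (r k)}).Finite → r ∉ P := by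
  classical
  constructor
  · rintro ⟨-, hwild⟩ r hfin hr
    have hsingle (k : S) : (Pi.single k 1 : Π k, R k) ∈ P :=
      not_not.mp fun hk => hwild (isTamePrime_of_single_one_notMem R hP hk)
    have hone : (1 : Π k, R k) =
        r * (fun k => Ring.inverse (r k)) + ∑ k ∈ hfin.toFinset, Pi.single k 1 := by
      ext j
      by_cases hj : IsUnit (r j)
      · simp [Finset.sum_apply, Finset.sum_pi_single, hj, Ring.mul_inverse_cancel]
      · simp [Finset.sum_apply, Finset.sum_pi_single, hj, Ring.inverse_non_unit]
    refine hP.ne_top ((Ideal.eq_top_iff_one P).mpr ?_)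
    rw [hone]
    exact P.add_mem (P.mul_mem_right _ hr) (P.sum_mem fun k _ => hsingle k)
  · refine fun h => ⟨hP, ?_⟩
    rintro ⟨k, p, -, rfl⟩
    refine h (1 - Pi.single k 1) ((Set.finite_singleton k).subset fun j hj => ?_) ?_
    · by_contra hjk
      exact hj (by simp [Pi.single_eq_of_ne (show j ≠ k from hjk)])
    · simp [Ideal.mem_comap]
end

section
/- Let (R_i)_{i∈S} be a family of nonzero commutative rings each of Krull dimension zero, and let R = ∏_{i∈S} R_i. Then R has Krull dimension zero if and only if the nilradical of R equals ∏_{i∈S} Nil(R_i), i.e., if and only if every element a = (a_i) ∈ R with each a_i nilpotent in R_i is itself nilpotent in R. -/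
/-- In a commutative ring all of whose primes are maximal, every element is von Neumann regular
modulo the nilradical. -/
theorem exists_isNilpotent_mul_one_sub_mul {A : Type*} [CommRing A]
    (h : ∀ p : Ideal A, p.IsPrime → p.IsMaximal) (x : A) :
    ∃ y, IsNilpotent (x * (1 - x * y)) := by
  let M : Submonoid A :=
    { carrier := {z | ∃ (n : ℕ) (y : A), z = x ^ n * (1 - x * y)}
      one_mem' := ⟨0, 0, by simp⟩
      mul_mem' := by
        rintro _ _ ⟨n, y, rfl⟩ ⟨m, z, rfl⟩
        exact ⟨n + m, y + z - x * y * z, by ring⟩ }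
  have hM : (0 : A) ∈ M := by
    by_contra h0
    obtain ⟨p, hp, -, hdisj⟩ := Ideal.exists_le_prime_disjoint (⊥ : Ideal A) M
      (Set.disjoint_left.mpr fun a ha haM => h0 (Ideal.mem_bot.mp ha ▸ haM))
    have hxM : x ∈ M := ⟨1, 0, by simp⟩
    have hx : x ∉ p := fun hxp => Set.disjoint_left.mp hdisj hxp hxM
    obtain ⟨y, i, hi, hy⟩ := (h p hp).exists_inv hx
    refine Set.disjoint_left.mp hdisj hi ⟨0, y, ?_⟩
    linear_combination hy
  obtain ⟨n, y, hy⟩ := hM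
  refine ⟨y, n + 1, ?_⟩
  rw [mul_pow, pow_succ, pow_succ]
  linear_combination -(x * (1 - x * y) ^ n) * hy

/-- If every element of a commutative ring is von Neumann regular modulo the nilradical, then
every prime ideal is maximal. -/
theorem Ideal.IsPrime.isMaximal_of_forall_exists_isNilpotent {A : Type*} [CommRing A]
    (h : ∀ x : A, ∃ y, IsNilpotent (x * (1 - x * y))) {P : Ideal A} (hP : P.IsPrime) :
    P.IsMaximal := by
  rw [Ideal.isMaximal_iff]
  refine ⟨fun h1 => hP.ne_top ((Ideal.eq_top_iff_one P).mpr h1), fun J x hPJ hxP hxJ => ?_⟩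
  obtain ⟨y, n, hn⟩ := h x
  have hmem : x * (1 - x * y) ∈ P := hP.mem_of_pow_mem n (hn ▸ P.zero_mem)
  have hy := hPJ ((hP.mem_or_mem hmem).resolve_left hxP)
  simpa using J.add_mem hy (J.mul_mem_right y hxJ)


/-- If each `R i` is a nonzero zero-dimensional commutative ring (every prime ideal is
maximal), then `R = Π i, R i` has Krull dimension zero iff its nilradical equals
`Π i, Nil(R i)`, i.e. iff every element all of whose coordinates are nilpotent is itself
nilpotent. -/
theorem krullDimZero_iff_nilradical_pi {S : Type*} (R : S → Type*)
    [∀ i, CommRing (R i)] [∀ i, Nontrivial (R i)]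
    (h : ∀ i, ∀ p : Ideal (R i), p.IsPrime → p.IsMaximal) :
    (∀ P : Ideal (Π i, R i), P.IsPrime → P.IsMaximal) ↔
      (∀ a : Π i, R i, (∀ i, IsNilpotent (a i)) → IsNilpotent a) := by
  refine ⟨fun hR a ha => ?_, fun hnil P hP => ?_⟩
  · obtain ⟨b, n, hn⟩ := exists_isNilpotent_mul_one_sub_mul hR a
    have hu : IsUnit (1 - a * b) := Pi.isUnit_iff.mpr fun i =>
      ((Commute.all (a i) (b i)).isNilpotent_mul_right (ha i)).isUnit_one_sub
    rw [mul_pow] at hn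
    exact ⟨n, (hu.pow n).mul_left_eq_zero.mp hn⟩
  · refine hP.isMaximal_of_forall_exists_isNilpotent fun a => ?_
    choose b hb using fun i => exists_isNilpotent_mul_one_sub_mul (h i) (a i)
    exact ⟨b, hnil _ hb⟩
end

section
/- Let R be a nonzero commutative ring having a maximal ideal of the form Rx generated by a single element x that is a non-zero-divisor of R. Then the Krull dimension of the direct product ring ∏_{n≥1} R/(x^n) is infinite, and the Krull dimension of ∏_{n≥1} R is infinite. -/
open Filter

theorem IsLeftRegular.pow_add_dvd_mul {R : Type*} [CommRing R] {x : R}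
    (hx : IsLeftRegular x) (hp : Prime x) {a b : ℕ} {f h : R}
    (hd : x ^ (a + b) ∣ f * h) : x ^ a ∣ f ∨ x ^ b ∣ h := by
  by_contra! hn
  obtain ⟨hf, hh⟩ := hn
  have exists_factor : ∀ {c : ℕ} {r : R}, ¬ x ^ c ∣ r → ∃ i < c, ∃ u, r = x ^ i * u ∧ ¬ x ∣ u := by
    intro c r hr
    have hfin : FiniteMultiplicity x r := ⟨c, fun h => hr ((pow_dvd_pow x c.le_succ).trans h)⟩
    obtain ⟨u, hu, hxu⟩ := hfin.exists_eq_pow_mul_and_not_dvd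
    refine ⟨_, ?_, u, hu, hxu⟩
    by_contra! hle
    exact hr ((pow_dvd_pow x hle).trans ⟨u, hu⟩)
  obtain ⟨i, hi, u, rfl, hu⟩ := exists_factor hf
  obtain ⟨j, hj, w, rfl, hw⟩ := exists_factor hh
  obtain ⟨t, ht⟩ := (pow_dvd_pow x (show i + j + 1 ≤ a + b by omega)).trans hd
  have huw : u * w = x * t := (hx.pow (i + j)) <| by
    simp only
    linear_combination ht
  exact (hp.dvd_or_dvd ⟨t, huw⟩).elim hu hw

theorem Ideal.Quotient.mk_pow_dvd_mk_iff {R : Type*} [CommRing R] {x : R} {a m : ℕ}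
    (ham : a ≤ m) {r : R} :
    Ideal.Quotient.mk (Ideal.span {x ^ m}) (x ^ a) ∣ Ideal.Quotient.mk (Ideal.span {x ^ m}) r ↔
      x ^ a ∣ r := by
  refine ⟨?_, map_dvd _⟩
  rintro ⟨q, hq⟩
  obtain ⟨q, rfl⟩ := Ideal.Quotient.mk_surjective q
  rw [← map_mul, Ideal.Quotient.mk_eq_mk_iff_sub_mem, Ideal.mem_span_singleton] at hq
  exact (dvd_sub_left (dvd_mul_right _ _)).mp ((pow_dvd_pow x ham).trans hq)

/-- The sequences which, along the index subsequence `m ↦ m ^ D` and the ultrafilter `U`, are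
divisible by `x` to an order exceeding every constant multiple of `m ^ i`. -/
def growthIdeal {R : Type*} [CommRing R] (x : R) (U : Ultrafilter ℕ) (D i : ℕ) :
    Ideal (Π n : ℕ, R ⧸ Ideal.span {x ^ (n + 1)}) where
  carrier := {f | ∀ k : ℕ, ∀ᶠ m in (U : Filter ℕ),
    Ideal.Quotient.mk (Ideal.span {x ^ (m ^ D + 1)}) (x ^ (k * m ^ i)) ∣ f (m ^ D)}
  add_mem' hf hg k := by
    filter_upwards [hf k, hg k] with m h₁ h₂ using dvd_add h₁ h₂
  zero_mem' k := Eventually.of_forall fun m => dvd_zero _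
  smul_mem' c f hf k := by
    filter_upwards [hf k] with m h using h.mul_left _

theorem eventually_mul_pow_le {U : Ultrafilter ℕ} (hU : (U : Filter ℕ) ≤ atTop) {i D : ℕ}
    (hi : i < D) (k : ℕ) : ∀ᶠ m in (U : Filter ℕ), k * m ^ i ≤ m ^ D := by
  filter_upwards [hU (eventually_ge_atTop k), hU (eventually_ge_atTop 1)] with m hk h₁
  calc k * m ^ i ≤ m * m ^ i := Nat.mul_le_mul_right _ hk
    _ = m ^ (i + 1) := (pow_succ' m i).symm
    _ ≤ m ^ D := Nat.pow_le_pow_right h₁ hi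

section

variable {R : Type*} [CommRing R] {x : R} {U : Ultrafilter ℕ} {D i j : ℕ}

theorem growthIdeal_isPrime (hx : IsLeftRegular x) (hp : Prime x)
    (hU : (U : Filter ℕ) ≤ atTop) (hi : i < D) : (growthIdeal x U D i).IsPrime := by
  refine Ideal.isPrime_iff.mpr ⟨?_, ?_⟩
  · rw [Ideal.ne_top_iff_one]
    intro h
    obtain ⟨m, hm, hle, hpos⟩ := ((h 1).and ((eventually_mul_pow_le hU hi 1).and
      (hU (eventually_gt_atTop 0)))).exists
    rw [Pi.one_apply, ← map_one (Ideal.Quotient.mk _),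
      Ideal.Quotient.mk_pow_dvd_mk_iff (by omega)] at hm
    exact hp.not_isUnit (isUnit_of_dvd_one ((dvd_pow_self x (by positivity)).trans hm))
  · intro f g hfg
    by_contra! hn
    obtain ⟨hf, hg⟩ := hn
    obtain ⟨k, hk⟩ := not_forall.mp hf
    obtain ⟨l, hl⟩ := not_forall.mp hg
    rw [← Ultrafilter.eventually_not] at hk hl
    obtain ⟨m, hm, hkm, hlm, hle⟩ := ((hfg (k + l)).and (hk.and (hl.and
      (eventually_mul_pow_le hU hi (k + l))))).exists
    obtain ⟨r, hr⟩ := Ideal.Quotient.mk_surjective (f (m ^ D))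
    obtain ⟨s, hs⟩ := Ideal.Quotient.mk_surjective (g (m ^ D))
    rw [add_mul] at hle
    rw [← hr, Ideal.Quotient.mk_pow_dvd_mk_iff (by omega)] at hkm
    rw [← hs, Ideal.Quotient.mk_pow_dvd_mk_iff (by omega)] at hlm
    rw [Pi.mul_apply, ← hr, ← hs, ← map_mul, add_mul,
      Ideal.Quotient.mk_pow_dvd_mk_iff (by omega)] at hm
    exact (hx.pow_add_dvd_mul hp hm).elim hkm hlm

theorem growthIdeal_lt (hx : IsLeftRegular x) (hp : Prime x)
    (hU : (U : Filter ℕ) ≤ atTop) (hij : i < j) (hj : j < D) :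
    growthIdeal x U D j < growthIdeal x U D i := by
  rw [SetLike.lt_iff_le_and_exists]
  refine ⟨fun f hf k => ?_, fun n => Ideal.Quotient.mk _
    (x ^ (Function.invFun (fun m : ℕ => m ^ D) n) ^ j), fun k => ?_, fun h => ?_⟩
  · filter_upwards [hf 1, eventually_mul_pow_le hU hij k] with m hm hle
    exact (map_dvd _ (pow_dvd_pow x (by simpa using hle))).trans hm
  all_goals
    have hinv : ∀ m : ℕ, Function.invFun (fun m : ℕ => m ^ D) (m ^ D) = m :=
      Function.leftInverse_invFun (Nat.pow_left_injective (by omega))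
  · filter_upwards [eventually_mul_pow_le hU hij k] with m hle
    rw [hinv]
    exact map_dvd _ (pow_dvd_pow x hle)
  · obtain ⟨m, hm, hle, hpos⟩ := ((h 2).and ((eventually_mul_pow_le hU hj 2).and
      (hU (eventually_gt_atTop 0)))).exists
    simp only [hinv] at hm
    rw [Ideal.Quotient.mk_pow_dvd_mk_iff (by omega)] at hm
    obtain ⟨t, ht⟩ := hm
    have hone : (1 : R) = x ^ m ^ j * t := (hx.pow (m ^ j)) <| by
      simp only
      rw [mul_one, ← mul_assoc, ← pow_add, ← two_mul]
      exact ht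
    exact hp.not_isUnit (isUnit_of_dvd_one ((dvd_pow_self x (by positivity)).trans ⟨t, hone⟩))

theorem ringKrullDim_pi_quotient_pow_eq_top_of_prime (hx : IsLeftRegular x) (hp : Prime x) :
    ringKrullDim (Π n : ℕ, R ⧸ Ideal.span {x ^ (n + 1)}) = ⊤ := by
  have hU : ((hyperfilter ℕ : Ultrafilter ℕ) : Filter ℕ) ≤ atTop := Nat.hyperfilter_le_atTop
  have : InfiniteDimensionalOrder (PrimeSpectrum (Π n : ℕ, R ⧸ Ideal.span {x ^ (n + 1)})) :=
    ⟨fun d => ⟨⟨d, fun i => ⟨growthIdeal x (hyperfilter ℕ) (d + 1) (d - i),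
        growthIdeal_isPrime hx hp hU (by omega)⟩, fun i => growthIdeal_lt hx hp hU
          (by simp only [Fin.val_succ, Fin.val_castSucc]; omega) (by omega)⟩, rfl⟩⟩
  exact Order.krullDim_eq_top

end


/-- If a nonzero commutative ring `R` has a maximal ideal `Rx` generated by a
non-zero-divisor `x`, then the Krull dimensions of `Π n ≥ 1, R/(xⁿ)` and of `Π n ≥ 1, R`
are infinite. -/
theorem ringKrullDim_pi_quotient_pow_eq_top {R : Type*} [CommRing R] [Nontrivial R]
    (x : R) (hx : x ∈ nonZeroDivisors R) (hmax : (Ideal.span {x}).IsMaximal) :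
    ringKrullDim (Π n : ℕ, R ⧸ Ideal.span {x ^ (n + 1)}) = ⊤ ∧
    ringKrullDim (Π _ : ℕ, R) = ⊤ := by
  have hreg : IsLeftRegular x := (isRegular_iff_mem_nonZeroDivisors.mpr hx).left
  have hp : Prime x := (Ideal.span_singleton_prime (nonZeroDivisors.ne_zero hx)).mp hmax.isPrime
  have htop := ringKrullDim_pi_quotient_pow_eq_top_of_prime hreg hp
  refine ⟨htop, top_le_iff.mp (htop ▸ ringKrullDim_le_of_surjective
    (RingHom.pi fun n => (Ideal.Quotient.mk (Ideal.span {x ^ (n + 1)})).comp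
      (Pi.evalRingHom (fun _ : ℕ => R) n)) fun f => ?_)⟩
  choose g hg using fun n => Ideal.Quotient.mk_surjective (f n)
  exact ⟨g, funext hg⟩
end

section
/- Let (R_i)_{i∈S} be a family of nonzero commutative rings each having the ideal avoidance property, let R = ∏_{i∈S} R_i, and let I = ⊕_{i∈S} R_i be the direct sum ideal. If the quotient ring R/I has the ideal avoidance property, then R has the ideal avoidance property. -/
/-- A commutative ring `A` is an *avoidance ring* if every ideal contained in a finite union
of ideals is contained in one of them. -/
def IsAvoidanceRing (A : Type*) [CommRing A] : Prop :=
  ∀ (J : Ideal A) (n : ℕ) (f : Fin n → Ideal A),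
    (J : Set A) ⊆ (⋃ i, (f i : Set A)) → ∃ i, J ≤ f i

theorem IsAvoidanceRing.exists_mem_forall_notMem {A : Type*} [CommRing A]
    (hA : IsAvoidanceRing A) {ι : Type*} [Finite ι] (J : Ideal A) (f : ι → Ideal A) :
    ∃ x ∈ J, ∀ k, ¬ J ≤ f k → x ∉ f k := by
  obtain ⟨m, ⟨e⟩⟩ := Finite.exists_equiv_fin {k // ¬ J ≤ f k}
  by_contra! hc
  obtain ⟨i, hi⟩ := hA J m (fun i => f (e.symm i)) fun x hx => by
    obtain ⟨k, hk, hxk⟩ := hc x hx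
    exact Set.mem_iUnion.2 ⟨e ⟨k, hk⟩, by simpa using hxk⟩
  exact (e.symm i).2 hi

section Pi

variable {S : Type*} [DecidableEq S] {R : S → Type*} [∀ i, CommRing (R i)]

theorem Ideal.single_apply_mem {J : Ideal (Π i, R i)} {x : Π i, R i} (hx : x ∈ J) (i : S) :
    Pi.single i (x i) ∈ J := by
  have hmul : Pi.single i (x i) = Pi.single i 1 * x := by
    rw [← Pi.single_mul_left, one_mul]
  exact hmul ▸ J.mul_mem_left _ hx

theorem Ideal.mem_map_evalRingHom {J : Ideal (Π i, R i)} {i : S} {a : R i} :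
    a ∈ J.map (Pi.evalRingHom R i) ↔ Pi.single i a ∈ J := by
  rw [Ideal.mem_map_iff_of_surjective _ (Function.surjective_eval i)]
  refine ⟨?_, fun ha => ⟨_, ha, by simp⟩⟩
  rintro ⟨x, hx, rfl⟩
  exact Ideal.single_apply_mem hx i

theorem sum_single_mem_directSumIdeal (F : Finset S) (x : Π i, R i) :
    ∑ i ∈ F, Pi.single i (x i) ∈ directSumIdeal R := by
  refine F.finite_toSet.subset fun i hi => ?_
  by_contra hF
  exact hi (by rw [Finset.sum_apply, Finset.sum_pi_single, if_neg (by simpa using hF)])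

theorem exists_eq_sum_single_of_mem_directSumIdeal {x : Π i, R i} (hx : x ∈ directSumIdeal R) :
    ∃ F : Finset S, x = ∑ i ∈ F, Pi.single i (x i) := by
  have hfin : {i | x i ≠ 0}.Finite := hx
  refine ⟨hfin.toFinset, funext fun i => ?_⟩
  rw [Finset.sum_apply, Finset.sum_pi_single]
  by_cases hi : x i = 0 <;> simp [hi]

theorem Ideal.le_of_map_evalRingHom_le_of_map_mk_le {J L : Ideal (Π i, R i)}
    (hloc : ∀ i, J.map (Pi.evalRingHom R i) ≤ L.map (Pi.evalRingHom R i))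
    (hquot : J.map (Ideal.Quotient.mk (directSumIdeal R)) ≤
      L.map (Ideal.Quotient.mk (directSumIdeal R))) : J ≤ L := by
  intro a ha
  obtain ⟨b, hb, hba⟩ := (Ideal.mem_map_iff_of_surjective _ Ideal.Quotient.mk_surjective).1
    (hquot (Ideal.mem_map_of_mem _ ha))
  obtain ⟨F, hF⟩ := exists_eq_sum_single_of_mem_directSumIdeal (Ideal.Quotient.eq.1 hba.symm)
  rw [← sub_add_cancel a b, hF]
  refine L.add_mem (L.sum_mem fun i _ => ?_) hb
  rw [Pi.sub_apply, Pi.single_sub]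
  exact L.sub_mem (mem_map_evalRingHom.1 (hloc i (Ideal.mem_map_of_mem (Pi.evalRingHom R i) ha)))
    (Ideal.single_apply_mem hb i)

end Pi

/-- If each `R i` is an avoidance ring and `R/⊕ i, R i` is an avoidance ring, then
`R = Π i, R i` is an avoidance ring. -/
theorem isAvoidanceRing_pi {S : Type*} (R : S → Type*) [∀ i, CommRing (R i)]
    [∀ i, Nontrivial (R i)] (h : ∀ i, IsAvoidanceRing (R i))
    (hq : IsAvoidanceRing ((Π i, R i) ⧸ directSumIdeal R)) :
    IsAvoidanceRing (Π i, R i) := by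
  classical
  intro J n f hJ
  by_contra! hf
  choose x hxJ hxf using fun i => (h i).exists_mem_forall_notMem
    (J.map (Pi.evalRingHom R i)) fun k => (f k).map (Pi.evalRingHom R i)
  obtain ⟨y', hy', hyf⟩ := hq.exists_mem_forall_notMem
    (J.map (Ideal.Quotient.mk _)) fun k => (f k).map (Ideal.Quotient.mk _)
  obtain ⟨y, hyJ, rfl⟩ :=
    (Ideal.mem_map_iff_of_surjective _ Ideal.Quotient.mk_surjective).1 hy'
  have hsupp : ∃ F : Finset S, ∀ k,
      (∃ i, ¬ J.map (Pi.evalRingHom R i) ≤ (f k).map (Pi.evalRingHom R i)) →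
      ∃ i ∈ F, ¬ J.map (Pi.evalRingHom R i) ≤ (f k).map (Pi.evalRingHom R i) := by
    choose g hg using fun (k : {k // ∃ i, ¬ J.map (Pi.evalRingHom R i) ≤
      (f k).map (Pi.evalRingHom R i)}) => k.2
    exact ⟨Finset.univ.image g, fun k hk =>
      ⟨g ⟨k, hk⟩, Finset.mem_image_of_mem g (Finset.mem_univ _), hg ⟨k, hk⟩⟩⟩
  obtain ⟨F, hF⟩ := hsupp
  set z : Π i, R i := y + ∑ i ∈ F, Pi.single i ((x - y : Π i, R i) i) with hz
  have hzJ : z ∈ J := by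
    refine J.add_mem hyJ (J.sum_mem fun i _ => ?_)
    rw [Pi.sub_apply, Pi.single_sub]
    exact sub_mem (Ideal.mem_map_evalRingHom.1 (hxJ i)) (Ideal.single_apply_mem hyJ i)
  obtain ⟨k, hk⟩ := Set.mem_iUnion.1 (hJ hzJ)
  by_cases hloc : ∃ i, ¬ J.map (Pi.evalRingHom R i) ≤ (f k).map (Pi.evalRingHom R i)
  · obtain ⟨i, hiF, hi⟩ := hF k hloc
    have hzi : z i = x i := by
      rw [hz, Pi.add_apply, Finset.sum_apply, Finset.sum_pi_single, if_pos hiF, Pi.sub_apply, add_sub_cancel]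
    exact hxf i k hi (hzi ▸ Ideal.mem_map_of_mem (Pi.evalRingHom R i) hk)
  · push Not at hloc
    refine hyf k (fun hquot => hf k (Ideal.le_of_map_evalRingHom_le_of_map_mk_le hloc hquot)) ?_
    have hzy : Ideal.Quotient.mk (directSumIdeal R) z = Ideal.Quotient.mk _ y := by
      rw [Ideal.Quotient.eq, hz, add_sub_cancel_left]
      exact sum_single_mem_directSumIdeal F _
    exact hzy ▸ Ideal.mem_map_of_mem _ hk
end

section
/- Let (R_i)_{i∈S} be a family of nonzero commutative rings, R = ∏_{i∈S} R_i, and fix k ∈ S. Then the closed set V(1 − e_k) = {P ∈ Spec(R) : 1 − e_k ∈ P} is a connected component of Spec(R) if and only if R_k has no nontrivial idempotents (i.e., every idempotent of R_k equals 0 or 1). -/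
/-- The spectrum of a commutative ring is preconnected iff the ring has no nontrivial idempotents. -/
theorem preconnectedSpace_primeSpectrum_iff {A : Type*} [CommRing A] :
    PreconnectedSpace (PrimeSpectrum A) ↔ ∀ e : A, IsIdempotentElem e → e = 0 ∨ e = 1 := by
  rw [preconnectedSpace_iff_clopen]
  constructor
  · intro h e he
    have hinj {e' : A} (he' : IsIdempotentElem e')
        (h' : (PrimeSpectrum.basicOpen e : Set (PrimeSpectrum A)) = PrimeSpectrum.basicOpen e') :
        e = e' :=
      PrimeSpectrum.basicOpen_injOn_isIdempotentElem he he' (TopologicalSpace.Opens.ext h')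
    rcases h _ (PrimeSpectrum.isClopen_iff.mpr ⟨e, he, rfl⟩) with h | h
    · exact .inl (hinj .zero (by simpa using h))
    · exact .inr (hinj .one (by simpa using h))
  · intro h s hs
    obtain ⟨e, he, rfl⟩ := PrimeSpectrum.isClopen_iff.mp hs
    rcases h e he with rfl | rfl <;> simp

/-- A nonempty clopen set is a connected component iff it is preconnected. -/
theorem IsClopen.exists_eq_connectedComponent_iff {X : Type*} [TopologicalSpace X] {s : Set X}
    (hs : IsClopen s) (hne : s.Nonempty) :
    (∃ x, s = connectedComponent x) ↔ IsPreconnected s := by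
  constructor
  · rintro ⟨x, rfl⟩
    exact isPreconnected_connectedComponent
  · intro h
    obtain ⟨x, hx⟩ := hne
    exact ⟨x, (h.subset_connectedComponent hx).antisymm (hs.connectedComponent_subset hx)⟩

theorem zeroLocus_one_sub_single_eq_range_comap {S : Type*} [DecidableEq S]
    (R : S → Type*) [∀ i, CommRing (R i)] (k : S) :
    PrimeSpectrum.zeroLocus {(1 : Π i, R i) - Pi.single k 1} =
      Set.range (PrimeSpectrum.comap (Pi.evalRingHom R k)) := by
  rw [range_comap_of_surjective _ _ (Function.surjective_eval k),
    ← PrimeSpectrum.zeroLocus_span]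
  congr 2
  ext x
  rw [Ideal.mem_span_singleton', RingHom.mem_ker,
    Pi.evalRingHom_apply]
  constructor
  · rintro ⟨a, rfl⟩
    simp
  · intro hx
    refine ⟨x, ?_⟩
    ext i
    rcases eq_or_ne i k with rfl | hi
    · simp [hx]
    · simp [hi]

/-- For `R = Π i, R i` and `k ∈ S`, the closed set `V(1 - e_k)` of `Spec(R)` is a connected
component of `Spec(R)` iff `R k` has no nontrivial idempotents. -/
theorem zeroLocus_one_sub_single_isConnectedComponent_iff {S : Type*} [DecidableEq S]
    (R : S → Type*) [∀ i, CommRing (R i)] [∀ i, Nontrivial (R i)] (k : S) :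
    (∃ P : PrimeSpectrum (Π i, R i),
        PrimeSpectrum.zeroLocus {(1 : Π i, R i) - Pi.single k 1} = connectedComponent P) ↔
    (∀ e : R k, IsIdempotentElem e → e = 0 ∨ e = 1) := by
  have hclopen : IsClopen (PrimeSpectrum.zeroLocus {(1 : Π i, R i) - Pi.single k 1}) :=
    PrimeSpectrum.isClopen_iff_zeroLocus.mpr ⟨_, IsIdempotentElem.one_sub (by
      rw [IsIdempotentElem, ← Pi.single_mul, one_mul]), rfl⟩
  have hrange := zeroLocus_one_sub_single_eq_range_comap R k
  rw [hclopen.exists_eq_connectedComponent_iff (hrange ▸ Set.range_nonempty _), hrange,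
    ← Set.image_univ, (PrimeSpectrum.isClosedEmbedding_comap_of_surjective _ _
      (Function.surjective_eval k)).isInducing.isPreconnected_image,
    ← preconnectedSpace_iff_univ, preconnectedSpace_primeSpectrum_iff]
end
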